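/- arXiv:1810.01779 — 2 statements merged into one kernel-verified Lean document; each statement's English description precedes it below -/
import Mathlib

section
/- Let 0 < v_min < v_max, let V = {υ ∈ ℝ³ : v_min ≤ ‖υ‖ ≤ v_max}, let a > 0, let D ⊆ ℝ³ be any set, and write [x, y] for the closed line segment from x to y. Then for every r ∈ ℝ³ and every measurable f : ℝ³ → [0, ∞]: ∫_V ∫₀^∞ e^{−a·s}·1_{[r, r+s·υ] ⊆ D}·f(r + s·υ) ds dυ ≥ v_min·(v_max − v_min)·∫_{ℝ³} 1_{[r, z] ⊆ D}·e^{−a‖z−r‖/v_min}·‖z − r‖^{−2}·f(z) dz. -/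
open MeasureTheory Set
open scoped ENNReal

/-- Lebesgue measure of dimension `n` under the affine dilation `υ ↦ r + s • υ`. -/
theorem lintegral_comp_add_smul {n : ℕ} (r : EuclideanSpace ℝ (Fin n)) {s : ℝ} (hs : 0 < s)
    {g : EuclideanSpace ℝ (Fin n) → ℝ≥0∞} (hg : Measurable g) :
    ∫⁻ υ, g (r + s • υ) = ENNReal.ofReal (s ^ n)⁻¹ * ∫⁻ z, g z := by
  have hm : Measurable fun z => g (r + z) := hg.comp (measurable_const_add r)
  rw [← lintegral_map (f := fun z => g (r + z)) hm (measurable_const_smul s),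
    Measure.map_addHaar_smul _ hs.ne', lintegral_smul_measure,
    lintegral_add_left_eq_self (fun z => g z) r, finrank_euclideanSpace_fin,
    abs_of_pos (by positivity), smul_eq_mul]

/-- The weight `s⁻³` integrated over the times at which a speed in `[vmin, vmax]` covers the
distance `ρ`. -/
theorem lintegral_travel_times {vmin vmax ρ : ℝ} (h1 : 0 < vmin) (h2 : vmin < vmax)
    (hρ : 0 < ρ) :
    ∫⁻ s in Ioi (0 : ℝ), {s : ℝ | vmin * s ≤ ρ ∧ ρ ≤ vmax * s}.indicator
        (fun s => ENNReal.ofReal (s ^ 3)⁻¹) s =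
      ENNReal.ofReal ((vmax ^ 2 - vmin ^ 2) / 2 / ρ ^ 2) := by
  have hmax : 0 < vmax := h1.trans h2
  have hset : {s : ℝ | vmin * s ≤ ρ ∧ ρ ≤ vmax * s} = Icc (ρ / vmax) (ρ / vmin) := by
    ext s
    simp only [mem_ofPred_eq, mem_Icc, div_le_iff₀' hmax, le_div_iff₀' h1, and_comm]
  have hpos : 0 < ρ / vmax := by positivity
  have hle : ρ / vmax ≤ ρ / vmin := by gcongr
  have hsub : Icc (ρ / vmax) (ρ / vmin) ⊆ Ioi 0 := fun s hs => hpos.trans_le hs.1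
  have hcont : ContinuousOn (fun s : ℝ => (s ^ 3)⁻¹) (Icc (ρ / vmax) (ρ / vmin)) :=
    (continuousOn_pow 3).inv₀ fun s hs => (pow_pos (hsub hs) 3).ne'
  rw [hset, lintegral_indicator measurableSet_Icc, Measure.restrict_restrict measurableSet_Icc,
    inter_eq_left.2 hsub, ← ofReal_integral_eq_lintegral_ofReal
      (hcont.integrableOn_compact isCompact_Icc)
      ((ae_restrict_iff' measurableSet_Icc).2 (.of_forall fun s hs =>
        inv_nonneg.2 (pow_pos (hsub hs) 3).le)),
    integral_Icc_eq_integral_Ioc, ← intervalIntegral.integral_of_le hle]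
  congr 1
  have hzero : (0 : ℝ) ∉ uIcc (ρ / vmax) (ρ / vmin) := by
    rw [uIcc_of_le hle]
    exact fun h => lt_irrefl (0 : ℝ) (hsub h)
  have hint := integral_zpow (n := -3) (Or.inr ⟨by norm_num, hzero⟩)
  have hpow : (fun s : ℝ => (s ^ 3)⁻¹) = fun s => s ^ (-3 : ℤ) := by
    ext s
    rw [zpow_neg]
    norm_cast
  rw [hpow, hint]
  norm_num [zpow_neg]
  field_simp
  ring

/-- Exact change of variables `z = r + s • υ` for the measure `s² ‖υ‖² ds dυ` over the velocity
annulus. -/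
theorem lintegral_velocity_time {vmin vmax : ℝ} (h1 : 0 < vmin) (h2 : vmin < vmax)
    (r : EuclideanSpace ℝ (Fin 3)) {g : EuclideanSpace ℝ (Fin 3) → ℝ≥0∞} (hg : Measurable g) :
    ∫⁻ υ in {υ : EuclideanSpace ℝ (Fin 3) | vmin ≤ ‖υ‖ ∧ ‖υ‖ ≤ vmax},
        ∫⁻ s in Ioi (0 : ℝ), ENNReal.ofReal (‖s • υ‖ ^ 2) * g (r + s • υ) =
      ENNReal.ofReal ((vmax ^ 2 - vmin ^ 2) / 2) * ∫⁻ z, g z := by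
  have hV : MeasurableSet {υ : EuclideanSpace ℝ (Fin 3) | vmin ≤ ‖υ‖ ∧ ‖υ‖ ≤ vmax} :=
    (measurableSet_le measurable_const measurable_norm).inter
      (measurableSet_le measurable_norm measurable_const)
  set A : Set (EuclideanSpace ℝ (Fin 3) × ℝ) :=
    {p | vmin * p.2 ≤ ‖p.1 - r‖ ∧ ‖p.1 - r‖ ≤ vmax * p.2} with hA_def
  have hdist : Measurable fun p : EuclideanSpace ℝ (Fin 3) × ℝ => ‖p.1 - r‖ := by fun_prop
  have hA : MeasurableSet A :=
    (measurableSet_le (measurable_snd.const_mul vmin) hdist).inter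
      (measurableSet_le hdist (measurable_snd.const_mul vmax))
  set w : EuclideanSpace ℝ (Fin 3) → ℝ≥0∞ := fun z => ENNReal.ofReal (‖z - r‖ ^ 2) * g z
    with hw_def
  have hw : Measurable w := by fun_prop
  have hAw : Measurable (A.indicator fun p => w p.1) := (hw.comp measurable_fst).indicator hA
  have hinv : Measurable fun s : ℝ => ENNReal.ofReal (s ^ 3)⁻¹ := by fun_prop
  calc
    _ = ∫⁻ s in Ioi (0 : ℝ), ∫⁻ υ in {υ : EuclideanSpace ℝ (Fin 3) | vmin ≤ ‖υ‖ ∧ ‖υ‖ ≤ vmax},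
          ENNReal.ofReal (‖s • υ‖ ^ 2) * g (r + s • υ) :=
      lintegral_lintegral_swap (Measurable.aemeasurable (by fun_prop))
    _ = ∫⁻ s in Ioi (0 : ℝ), ∫⁻ υ, A.indicator (fun p => w p.1) (r + s • υ, s) := by
      refine setLIntegral_congr_fun measurableSet_Ioi fun s hs => ?_
      have hs : 0 < s := hs
      rw [← lintegral_indicator hV]
      refine lintegral_congr fun υ => ?_
      have hmem : (r + s • υ, s) ∈ A ↔
          υ ∈ {υ : EuclideanSpace ℝ (Fin 3) | vmin ≤ ‖υ‖ ∧ ‖υ‖ ≤ vmax} := by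
        simp only [hA_def, mem_ofPred_eq, add_sub_cancel_left, norm_smul, Real.norm_eq_abs,
          abs_of_pos hs, mul_comm _ s, mul_le_mul_iff_right₀ hs]
      by_cases hυ : υ ∈ {υ : EuclideanSpace ℝ (Fin 3) | vmin ≤ ‖υ‖ ∧ ‖υ‖ ≤ vmax}
      · rw [indicator_of_mem hυ, indicator_of_mem (hmem.2 hυ)]
        simp [hw_def]
      · rw [indicator_of_notMem hυ, indicator_of_notMem (mt hmem.1 hυ)]
    _ = ∫⁻ s in Ioi (0 : ℝ), ∫⁻ z,
          ENNReal.ofReal (s ^ 3)⁻¹ * A.indicator (fun p => w p.1) (z, s) := by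
      refine setLIntegral_congr_fun measurableSet_Ioi fun s hs => ?_
      have hsec : Measurable fun z => A.indicator (fun p => w p.1) (z, s) :=
        hAw.comp measurable_prodMk_right
      rw [lintegral_comp_add_smul r hs hsec, lintegral_const_mul _ hsec]
    _ = ∫⁻ z, ∫⁻ s in Ioi (0 : ℝ),
          ENNReal.ofReal (s ^ 3)⁻¹ * A.indicator (fun p => w p.1) (z, s) :=
      lintegral_lintegral_swap (Measurable.aemeasurable
        ((hinv.comp measurable_fst).mul (hAw.comp measurable_swap)))
    _ = ∫⁻ z, ENNReal.ofReal ((vmax ^ 2 - vmin ^ 2) / 2) * g z := by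
      refine lintegral_congr_ae ?_
      filter_upwards [Measure.ae_ne volume r] with z hz
      have hρ : 0 < ‖z - r‖ := norm_pos_iff.2 (sub_ne_zero.2 hz)
      have hfactor (s : ℝ) : ENNReal.ofReal (s ^ 3)⁻¹ * A.indicator (fun p => w p.1) (z, s) =
          {s : ℝ | vmin * s ≤ ‖z - r‖ ∧ ‖z - r‖ ≤ vmax * s}.indicator
            (fun s => ENNReal.ofReal (s ^ 3)⁻¹) s * w z := by
        simp only [indicator, hA_def, mem_ofPred_eq]
        split_ifs <;> simp
      have hmeas : MeasurableSet {s : ℝ | vmin * s ≤ ‖z - r‖ ∧ ‖z - r‖ ≤ vmax * s} :=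
        (measurableSet_le (measurable_const_mul vmin) measurable_const).inter
          (measurableSet_le measurable_const (measurable_const_mul vmax))
      have hsq : vmin ^ 2 ≤ vmax ^ 2 := by gcongr
      simp only [hfactor]
      rw [lintegral_mul_const _ (hinv.indicator hmeas), lintegral_travel_times h1 h2 hρ,
        hw_def, ← mul_assoc, ← ENNReal.ofReal_mul
          (div_nonneg (div_nonneg (sub_nonneg.2 hsq) zero_le_two) (sq_nonneg _)),
        div_mul_cancel₀ _ (pow_pos hρ 2).ne']
    _ = _ := lintegral_const_mul _ hg

/-- polar-coordinates lower bound for the first-jump position. For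
the velocity annulus `V = {vmin ≤ ‖υ‖ ≤ vmax}`, any `a > 0`, any set `D ⊆ ℝ³` and any
`r ∈ ℝ³`, one has
`∫_V ∫₀^∞ e^{−as} 1_{[r, r+sυ] ⊆ D} f(r + sυ) ds dυ
   ≥ vmin (vmax − vmin) ∫_{ℝ³} 1_{[r,z] ⊆ D} e^{−a‖z−r‖/vmin} ‖z−r‖⁻² f(z) dz`. -/
theorem velocity_time_change_of_variables_lower (vmin vmax a : ℝ)
    (h1 : 0 < vmin) (h2 : vmin < vmax) (ha : 0 < a)
    (D : Set (EuclideanSpace ℝ (Fin 3))) (r : EuclideanSpace ℝ (Fin 3))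
    (f : EuclideanSpace ℝ (Fin 3) → ℝ≥0∞) (hf : Measurable f) :
    ENNReal.ofReal (vmin * (vmax - vmin)) *
        (∫⁻ z, {z : EuclideanSpace ℝ (Fin 3) | segment ℝ r z ⊆ D}.indicator
          (fun z => ENNReal.ofReal (Real.exp (-(a * ‖z - r‖ / vmin)) / ‖z - r‖ ^ 2) * f z) z) ≤
      ∫⁻ υ in {υ : EuclideanSpace ℝ (Fin 3) | vmin ≤ ‖υ‖ ∧ ‖υ‖ ≤ vmax},
        ∫⁻ s in Ioi (0:ℝ), {s : ℝ | segment ℝ r (r + s • υ) ⊆ D}.indicator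
          (fun s => ENNReal.ofReal (Real.exp (-(a * s))) * f (r + s • υ)) s := by
  obtain ⟨g, hg, hgle, hgeq⟩ := exists_measurable_le_lintegral_eq volume
    ({z : EuclideanSpace ℝ (Fin 3) | segment ℝ r z ⊆ D}.indicator
      (fun z => ENNReal.ofReal (Real.exp (-(a * ‖z - r‖ / vmin)) / ‖z - r‖ ^ 2) * f z))
  have hV : MeasurableSet {υ : EuclideanSpace ℝ (Fin 3) | vmin ≤ ‖υ‖ ∧ ‖υ‖ ≤ vmax} :=
    (measurableSet_le measurable_const measurable_norm).inter
      (measurableSet_le measurable_norm measurable_const)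
  calc
    _ = ENNReal.ofReal (vmin * (vmax - vmin)) * ∫⁻ z, g z := by rw [hgeq]
    _ ≤ ENNReal.ofReal ((vmax ^ 2 - vmin ^ 2) / 2) * ∫⁻ z, g z := by
      gcongr
      nlinarith [sq_nonneg (vmax - vmin)]
    _ = _ := (lintegral_velocity_time h1 h2 r hg).symm
    _ ≤ _ := by
      refine setLIntegral_mono' hV fun υ hυ => setLIntegral_mono' measurableSet_Ioi fun s hs => ?_
      have hs : 0 < s := hs
      have hυ0 : 0 < ‖υ‖ := h1.trans_le hυ.1
      have hnorm : ‖s • υ‖ = s * ‖υ‖ := by rw [norm_smul, Real.norm_eq_abs, abs_of_pos hs]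
      have hρ : 0 < ‖s • υ‖ := by rw [hnorm]; positivity
      have hexp : a * s ≤ a * ‖s • υ‖ / vmin := by
        rw [hnorm, le_div_iff₀ h1, mul_assoc]
        gcongr
        exact hυ.1
      have hgz := hgle (r + s • υ)
      by_cases hz : segment ℝ r (r + s • υ) ⊆ D
      · rw [indicator_of_mem (by exact hz), add_sub_cancel_left] at hgz
        rw [indicator_of_mem (by exact hz)]
        calc
          _ ≤ ENNReal.ofReal (‖s • υ‖ ^ 2) *
              (ENNReal.ofReal (Real.exp (-(a * ‖s • υ‖ / vmin)) / ‖s • υ‖ ^ 2) *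
                f (r + s • υ)) := by gcongr
          _ = ENNReal.ofReal (Real.exp (-(a * ‖s • υ‖ / vmin))) * f (r + s • υ) := by
            rw [← mul_assoc, ← ENNReal.ofReal_mul (sq_nonneg _),
              mul_div_cancel₀ _ (pow_pos hρ 2).ne']
          _ ≤ _ := by gcongr
      · rw [indicator_of_notMem (by exact hz)] at hgz
        rw [nonpos_iff_eq_zero.1 hgz, mul_zero]
        exact zero_le
end

section
/- Let 0 < v_min < v_max, let V = {υ ∈ ℝ³ : v_min ≤ ‖υ‖ ≤ v_max}, and let T > 0. Then there exists a constant C > 0, depending only on v_min, v_max and T, such that for every r₀ ∈ ℝ³, every υ₀ ∈ V, and every measurable g : ℝ³ → [0, ∞]: ∫_{[0,T]^7} ∫_{V^6} g(r₀ + u₁·υ₀ + u₂·υ₁ + u₃·υ₂ + u₄·υ₃ + u₅·υ₄ + u₆·υ₅ + u₇·υ₆) dυ₁⋯dυ₆ du₁⋯du₇ ≤ C·∫_{ℝ³} g(x) dx. -/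
open MeasureTheory Set
open scoped ENNReal

/-- `iteratedSmoothing μ V g [u₁, …, uₙ] z` integrates `g (z + u₁ • v₁ + ⋯ + uₙ • vₙ)` over all
velocities `v₁, …, vₙ ∈ V`. -/
noncomputable def iteratedSmoothing {E : Type*} [AddCommGroup E] [Module ℝ E] [MeasurableSpace E]
    (μ : Measure E) (V : Set E) (g : E → ℝ≥0∞) : List ℝ → E → ℝ≥0∞
  | [] => g
  | u :: l => fun z => ∫⁻ v in V, iteratedSmoothing μ V g l (z + u • v) ∂μ

section IteratedSmoothing

variable {E : Type*} [NormedAddCommGroup E] [NormedSpace ℝ E] [FiniteDimensional ℝ E]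
  [MeasurableSpace E] [BorelSpace E] (μ : Measure E) [μ.IsAddHaarMeasure] (V : Set E)
  {g : E → ℝ≥0∞}

theorem measurable_iteratedSmoothing (hg : Measurable g) (l : List ℝ) :
    Measurable (iteratedSmoothing μ V g l) := by
  induction l with
  | nil => exact hg
  | cons u l ih =>
    have h : Measurable fun p : E × E => iteratedSmoothing μ V g l (p.1 + u • p.2) := by fun_prop
    exact h.lintegral_prod_right'

theorem lintegral_iteratedSmoothing (hg : Measurable g) (l : List ℝ) :
    ∫⁻ z, iteratedSmoothing μ V g l z ∂μ = μ V ^ l.length * ∫⁻ z, g z ∂μ := by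
  induction l with
  | nil => simp [iteratedSmoothing]
  | cons u l ih =>
    have hl := measurable_iteratedSmoothing μ V hg l
    have h : Measurable fun p : E × E => iteratedSmoothing μ V g l (p.1 + u • p.2) := by fun_prop
    simp only [iteratedSmoothing]
    rw [lintegral_lintegral_swap h.aemeasurable]
    simp only [lintegral_add_right_eq_self (iteratedSmoothing μ V g l), ih, lintegral_const,
      Measure.restrict_apply_univ, List.length_cons]
    ring

theorem lintegral_comp_add_smul_s14 {f : E → ℝ≥0∞} (hf : Measurable f) (z : E) {u : ℝ} (hu : u ≠ 0) :
    ∫⁻ v, f (z + u • v) ∂μ =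
      ENNReal.ofReal |(u ^ Module.finrank ℝ E)⁻¹| * ∫⁻ x, f x ∂μ := by
  have h := lintegral_map (μ := μ) (f := fun x => f (z + x)) (g := fun v : E => u • v)
    (by fun_prop) (by fun_prop)
  rw [Measure.map_addHaar_smul μ hu, lintegral_smul_measure,
    lintegral_add_left_eq_self f z] at h
  exact h.symm

theorem iteratedSmoothing_le (hg : Measurable g) {l : List ℝ} {u : ℝ} (hu : u ≠ 0) (hl : u ∈ l)
    (z : E) :
    iteratedSmoothing μ V g l z ≤
      μ V ^ (l.length - 1) * (∫⁻ x, g x ∂μ) * ENNReal.ofReal |(u ^ Module.finrank ℝ E)⁻¹| := by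
  induction l generalizing z with
  | nil => simp at hl
  | cons w l ih =>
    simp only [iteratedSmoothing]
    by_cases hw : u = w
    · subst hw
      refine (setLIntegral_le_lintegral V _).trans ?_
      rw [lintegral_comp_add_smul_s14 μ (measurable_iteratedSmoothing μ V hg l) z hu,
        lintegral_iteratedSmoothing μ V hg, mul_comm]
      simp
    · have hl' : u ∈ l := by simpa [hw] using hl
      have hlen : l.length = l.length - 1 + 1 := by have := List.length_pos_of_mem hl'; omega
      refine (lintegral_mono fun v => ih hl' (z + w • v)).trans_eq ?_
      rw [lintegral_const, Measure.restrict_apply_univ, List.length_cons, Nat.add_sub_cancel,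
        hlen, pow_succ, Nat.add_sub_cancel]
      ring

end IteratedSmoothing

/-- A quantity bounded by the sixth power of each of six factors is bounded by their product. -/
theorem le_mul_prod_of_forall_le_mul_pow {ι : Type*} [Fintype ι] [Nonempty ι]
    {J M : ℝ≥0∞} {c : ι → ℝ≥0∞} (h : ∀ i, J ≤ M * c i ^ Fintype.card ι) : J ≤ M * ∏ i, c i := by
  obtain ⟨i, hi⟩ := Finite.exists_min c
  refine (h i).trans ?_
  gcongr
  exact Finset.pow_card_le_prod _ _ _ fun j _ => hi j

theorem lintegral_rpow_neg_half_lt_top {T : ℝ} (hT : 0 ≤ T) :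
    ∫⁻ u in Ioc 0 T, ENNReal.ofReal (u ^ (-(1 / 2) : ℝ)) < ∞ := by
  have h := intervalIntegral.intervalIntegrable_rpow' (a := 0) (b := T) (r := -(1 / 2))
    (by norm_num)
  exact ((intervalIntegrable_iff_integrableOn_Ioc_of_le hT).1 h).lintegral_lt_top

theorem ofReal_rpow_neg_half_pow_six {u : ℝ} (hu : 0 < u) :
    ENNReal.ofReal (u ^ (-(1 / 2) : ℝ)) ^ 6 = ENNReal.ofReal |(u ^ 3)⁻¹| := by
  rw [← ENNReal.ofReal_pow (by positivity), abs_of_pos (by positivity), ← Real.rpow_natCast,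
    ← Real.rpow_mul hu.le, ← Real.rpow_natCast, ← Real.rpow_neg hu.le]
  norm_num

/-- seven-fold smoothing bound, Lemma 7.4 of the paper. For the
velocity annulus `V = {vmin ≤ ‖υ‖ ≤ vmax}` and any horizon `T > 0` there is a constant
`C > 0`, depending only on `vmin`, `vmax`, `T`, such that for all starting data
`(r₀, υ₀)` with `υ₀ ∈ V` and every measurable `g : ℝ³ → [0,∞]`,
`∫_{[0,T]⁷} ∫_{V⁶} g(r₀ + u₁υ₀ + u₂υ₁ + ⋯ + u₇υ₆) ≤ C ∫_{ℝ³} g(x) dx`. -/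
theorem sevenfold_smoothing_bound (vmin vmax T : ℝ)
    (h1 : 0 < vmin) (h2 : vmin < vmax) (hT : 0 < T) :
    ∃ C : ℝ, 0 < C ∧
      ∀ (r₀ υ₀ : EuclideanSpace ℝ (Fin 3)),
        υ₀ ∈ {υ : EuclideanSpace ℝ (Fin 3) | vmin ≤ ‖υ‖ ∧ ‖υ‖ ≤ vmax} →
        ∀ g : EuclideanSpace ℝ (Fin 3) → ℝ≥0∞, Measurable g →
        (∫⁻ u₁ in Icc (0:ℝ) T, ∫⁻ u₂ in Icc (0:ℝ) T, ∫⁻ u₃ in Icc (0:ℝ) T,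
          ∫⁻ u₄ in Icc (0:ℝ) T, ∫⁻ u₅ in Icc (0:ℝ) T, ∫⁻ u₆ in Icc (0:ℝ) T,
          ∫⁻ u₇ in Icc (0:ℝ) T,
          ∫⁻ υ₁ in {υ : EuclideanSpace ℝ (Fin 3) | vmin ≤ ‖υ‖ ∧ ‖υ‖ ≤ vmax},
          ∫⁻ υ₂ in {υ : EuclideanSpace ℝ (Fin 3) | vmin ≤ ‖υ‖ ∧ ‖υ‖ ≤ vmax},
          ∫⁻ υ₃ in {υ : EuclideanSpace ℝ (Fin 3) | vmin ≤ ‖υ‖ ∧ ‖υ‖ ≤ vmax},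
          ∫⁻ υ₄ in {υ : EuclideanSpace ℝ (Fin 3) | vmin ≤ ‖υ‖ ∧ ‖υ‖ ≤ vmax},
          ∫⁻ υ₅ in {υ : EuclideanSpace ℝ (Fin 3) | vmin ≤ ‖υ‖ ∧ ‖υ‖ ≤ vmax},
          ∫⁻ υ₆ in {υ : EuclideanSpace ℝ (Fin 3) | vmin ≤ ‖υ‖ ∧ ‖υ‖ ≤ vmax},
            g (r₀ + u₁ • υ₀ + u₂ • υ₁ + u₃ • υ₂ + u₄ • υ₃ + u₅ • υ₄ + u₆ • υ₅ + u₇ • υ₆)) ≤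
        ENNReal.ofReal C * ∫⁻ x, g x := by
  set V : Set (EuclideanSpace ℝ (Fin 3)) := {υ | vmin ≤ ‖υ‖ ∧ ‖υ‖ ≤ vmax}
  set c : ℝ → ℝ≥0∞ := fun u => ENNReal.ofReal (u ^ (-(1 / 2) : ℝ)) with hc
  have hcm : Measurable c := by fun_prop
  have hV : volume V < ∞ := (measure_mono fun υ hυ => by simpa using hυ.2).trans_lt
    (measure_closedBall_lt_top (x := 0) (r := vmax))
  set L : ℝ≥0∞ := ∫⁻ u in Ioc 0 T, c u with hL
  have hLtop : L < ∞ := lintegral_rpow_neg_half_lt_top hT.le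
  set K : ℝ≥0∞ := volume V ^ 5 * L ^ 6 * ENNReal.ofReal T with hK
  have hKtop : K ≠ ∞ := by finiteness
  refine ⟨K.toReal + 1, by positivity, fun r₀ υ₀ _ g hg => ?_⟩
  have hKC : K ≤ ENNReal.ofReal (K.toReal + 1) := by
    rw [ENNReal.le_ofReal_iff_toReal_le hKtop (by positivity)]
    linarith
  refine le_trans ?_ (mul_le_mul_left hKC _)
  rw [Measure.restrict_congr_set (Ioc_ae_eq_Icc (a := (0 : ℝ)) (b := T)).symm]
  set M : ℝ≥0∞ := volume V ^ 5 * ∫⁻ x, g x with hM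
  calc
    _ ≤ ∫⁻ _ in Ioc 0 T, ∫⁻ u₂ in Ioc 0 T, ∫⁻ u₃ in Ioc 0 T, ∫⁻ u₄ in Ioc 0 T,
        ∫⁻ u₅ in Ioc 0 T, ∫⁻ u₆ in Ioc 0 T, ∫⁻ u₇ in Ioc 0 T,
          M * c u₂ * c u₃ * c u₄ * c u₅ * c u₆ * c u₇ := by
      refine setLIntegral_mono' measurableSet_Ioc fun u₁ _ => ?_
      refine setLIntegral_mono' measurableSet_Ioc fun u₂ h₂ => ?_
      refine setLIntegral_mono' measurableSet_Ioc fun u₃ h₃ => ?_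
      refine setLIntegral_mono' measurableSet_Ioc fun u₄ h₄ => ?_
      refine setLIntegral_mono' measurableSet_Ioc fun u₅ h₅ => ?_
      refine setLIntegral_mono' measurableSet_Ioc fun u₆ h₆ => ?_
      refine setLIntegral_mono' measurableSet_Ioc fun u₇ h₇ => ?_
      have key := le_mul_prod_of_forall_le_mul_pow
        (J := iteratedSmoothing volume V g [u₂, u₃, u₄, u₅, u₆, u₇] (r₀ + u₁ • υ₀)) (M := M)
        (c := fun i : Fin 6 => c (![u₂, u₃, u₄, u₅, u₆, u₇] i)) fun i => by
          have hpos : 0 < ![u₂, u₃, u₄, u₅, u₆, u₇] i := by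
            fin_cases i
            exacts [h₂.1, h₃.1, h₄.1, h₅.1, h₆.1, h₇.1]
          rw [Fintype.card_fin, hc, ofReal_rpow_neg_half_pow_six hpos]
          have hle := iteratedSmoothing_le volume V hg (l := [u₂, u₃, u₄, u₅, u₆, u₇]) hpos.ne'
            (by fin_cases i <;> simp) (r₀ + u₁ • υ₀)
          simpa using hle
      simpa [iteratedSmoothing, Fin.prod_univ_six, mul_assoc] using key
    _ = K * ∫⁻ x, g x := by
      simp only [lintegral_const_mul _ hcm, ← hL, lintegral_const,
        lintegral_mul_const' L _ hLtop.ne,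
        Measure.restrict_apply_univ, Real.volume_Ioc, sub_zero]
      rw [hK, hM]
      ring
end
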